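/- arXiv:2502.14105 — 4 statements merged into one kernel-verified Lean document; each statement's English description precedes it below -/
import Mathlib

section
/- Let P, P̃, Q be Borel probability measures on Z, let ε ≥ 0 and ρ ∈ [0,1]. If LP_ε(P, P̃) = 0 and TV(P̃, Q) ≤ ρ, then LP_ε(P, Q) ≤ ρ. (The gluing direction of the decomposition of the LP ambiguity set: a local ∞-Wasserstein perturbation of size ε followed by a total-variation perturbation of size ρ stays in the LP ball B_{ε,ρ}(P).) -/
open MeasureTheory

/-- The Lévy–Prokhorov discrepancy `LP_ε(P,Q)`. -/
noncomputable def LPdist {E : Type*} [NormedAddCommGroup E] [MeasurableSpace E]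
    (ε : ℝ) (P Q : Measure E) : ENNReal :=
  ⨅ (γ : Measure (E × E)) (_ : γ.map Prod.fst = P ∧ γ.map Prod.snd = Q),
    γ {p : E × E | ε < ‖p.1 - p.2‖}

/-- The total variation discrepancy. -/
noncomputable def TVdist {E : Type*} [MeasurableSpace E] (P Q : Measure E) : ENNReal :=
  ⨅ (γ : Measure (E × E)) (_ : γ.map Prod.fst = P ∧ γ.map Prod.snd = Q),
    γ {p : E × E | p.1 ≠ p.2}

open ProbabilityTheory

/-- **Gluing lemma**: two finite measures on products sharing the marginal on `Y` are the marginals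
of a measure on `Y × (X × W)`. -/
theorem exists_gluing {X Y W : Type*} [MeasurableSpace X] [MeasurableSpace Y] [MeasurableSpace W]
    [StandardBorelSpace X] [Nonempty X] [StandardBorelSpace W] [Nonempty W]
    (γ₁ : Measure (X × Y)) (γ₂ : Measure (Y × W)) [IsFiniteMeasure γ₁] [IsFiniteMeasure γ₂]
    (h : γ₁.map Prod.snd = γ₂.map Prod.fst) :
    ∃ π : Measure (Y × (X × W)),
      π.map (fun p => (p.2.1, p.1)) = γ₁ ∧ π.map (fun p => (p.1, p.2.2)) = γ₂ := by
  have hfst : (γ₁.map Prod.swap).fst = γ₂.fst := by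
    rw [Measure.fst_map_swap]; exact h
  set κ₁ := (γ₁.map Prod.swap).condKernel
  set κ₂ := γ₂.condKernel
  refine ⟨γ₂.fst ⊗ₘ (κ₁ ×ₖ κ₂), ?_, ?_⟩
  · have h₁ : (γ₂.fst ⊗ₘ (κ₁ ×ₖ κ₂)).map (Prod.map id Prod.fst) = γ₁.map Prod.swap := by
      rw [← Measure.compProd_map measurable_fst, ← Kernel.fst_eq, Kernel.fst_prod, ← hfst]
      exact (γ₁.map Prod.swap).disintegrate _
    have h₂ := congrArg (Measure.map Prod.swap) h₁
    rw [Measure.map_map measurable_swap (by fun_prop),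
      Measure.map_map measurable_swap measurable_swap, Prod.swap_swap_eq, Measure.map_id] at h₂
    exact h₂
  · have h₁ : (γ₂.fst ⊗ₘ (κ₁ ×ₖ κ₂)).map (Prod.map id Prod.snd) = γ₂ := by
      rw [← Measure.compProd_map measurable_snd, ← Kernel.snd_eq, Kernel.snd_prod]
      exact γ₂.disintegrate _
    exact h₁

/-- Mixed triangle inequality for the Lévy–Prokhorov and total variation discrepancies. -/
theorem LPdist_le_add_TVdist {E : Type*} [NormedAddCommGroup E] [MeasurableSpace E] [BorelSpace E]
    [SecondCountableTopology E] [CompleteSpace E] (ε : ℝ) (P R Q : Measure E) [IsFiniteMeasure R] :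
    LPdist ε P Q ≤ LPdist ε P R + TVdist R Q := by
  unfold LPdist TVdist
  simp only [ENNReal.iInf_add, ENNReal.add_iInf]
  refine le_iInf fun γ₂ => le_iInf fun h₂ => le_iInf fun γ₁ => le_iInf fun h₁ => ?_
  have : IsFiniteMeasure γ₁ :=
    have : IsFiniteMeasure (γ₁.map Prod.snd) := by rw [h₁.2]; infer_instance
    Measure.isFiniteMeasure_of_map measurable_snd.aemeasurable
  have : IsFiniteMeasure γ₂ :=
    have : IsFiniteMeasure (γ₂.map Prod.fst) := by rw [h₂.1]; infer_instance
    Measure.isFiniteMeasure_of_map measurable_fst.aemeasurable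
  obtain ⟨π, rfl, rfl⟩ := exists_gluing γ₁ γ₂ (h₁.2.trans h₂.1.symm)
  have hm₁ : Measurable fun p : E × (E × E) => (p.2.1, p.1) := by fun_prop
  have hm₂ : Measurable fun p : E × (E × E) => (p.1, p.2.2) := by fun_prop
  rw [Measure.map_map (by fun_prop) hm₁, Measure.map_map (by fun_prop) hm₁] at h₁
  rw [Measure.map_map (by fun_prop) hm₂, Measure.map_map (by fun_prop) hm₂] at h₂
  have hπ : (π.map Prod.snd).map Prod.fst = P ∧ (π.map Prod.snd).map Prod.snd = Q := by
    constructor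
    · rw [Measure.map_map (by fun_prop) (by fun_prop)]; exact h₁.1
    · rw [Measure.map_map (by fun_prop) (by fun_prop)]; exact h₂.2
  refine (iInf₂_le (π.map Prod.snd) hπ).trans ?_
  have hS : MeasurableSet {p : E × E | ε < ‖p.1 - p.2‖} :=
    measurableSet_lt (by fun_prop) (by fun_prop)
  have hD : MeasurableSet {p : E × E | p.1 ≠ p.2} := measurableSet_diagonal.compl
  rw [Measure.map_apply measurable_snd hS, Measure.map_apply hm₁ hS, Measure.map_apply hm₂ hD]
  refine (measure_mono fun p hp => ?_).trans (measure_union_le _ _)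
  by_cases hpq : p.1 = p.2.2
  · left
    simpa [hpq] using hp
  · exact Or.inr hpq

/-- Gluing direction of the decomposition of the LP ambiguity set: a local `∞`-Wasserstein
perturbation of size `ε` followed by a total-variation perturbation of size `ρ` stays in the
LP ball `B_{ε,ρ}(P)`. -/
theorem lp_ball_gluing {Z : Type*} [NormedAddCommGroup Z] [NormedSpace ℝ Z]
    [FiniteDimensional ℝ Z] [MeasurableSpace Z] [BorelSpace Z]
    (P Ptilde Q : Measure Z) [IsProbabilityMeasure P] [IsProbabilityMeasure Ptilde]
    [IsProbabilityMeasure Q]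
    (ε ρ : ℝ) (hε : 0 ≤ ε) (hρ0 : 0 ≤ ρ) (hρ1 : ρ ≤ 1)
    (hW : LPdist ε P Ptilde = 0) (hTV : TVdist Ptilde Q ≤ ENNReal.ofReal ρ) :
    LPdist ε P Q ≤ ENNReal.ofReal ρ := by
  have : ProperSpace Z := FiniteDimensional.proper ℝ Z
  calc LPdist ε P Q ≤ LPdist ε P Ptilde + TVdist Ptilde Q := LPdist_le_add_TVdist ε P Ptilde Q
    _ ≤ ENNReal.ofReal ρ := by rwa [hW, zero_add]
end

section
/- For all Borel probability measures P, Q on Z and every ε ≥ 0: LP_ε(P,Q) = 0 if and only if there exists a coupling γ ∈ Γ(P,Q) such that γ({(z₁,z₂) : ‖z₁ − z₂‖ > ε}) = 0, i.e., ‖z₁ − z₂‖ ≤ ε holds γ-almost surely. Consequently, the LP ambiguity set B_{ε,0}(P) coincides with the ∞-Wasserstein ball {Q ∈ 𝒫(Z) : W_∞(P,Q) ≤ ε}, where W_∞(P,Q) ≤ ε means that some coupling of P and Q is concentrated on {‖z₁ − z₂‖ ≤ ε}. -/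
open MeasureTheory

open Filter

/-- The mass of a fixed open set is lower semicontinuous for the weak topology. -/
theorem lowerSemicontinuous_measure_of_isOpen {X : Type*} [MeasurableSpace X]
    [TopologicalSpace X] [OpensMeasurableSpace X] [HasOuterApproxClosed X] {G : Set X}
    (hG : IsOpen G) :
    LowerSemicontinuous fun μ : ProbabilityMeasure X ↦ (μ : Measure X) G :=
  lowerSemicontinuous_iff_le_liminf.2 fun _ ↦
    ProbabilityMeasure.le_liminf_measure_open_of_tendsto tendsto_id hG

section Coupling

variable {X Y : Type*} [MeasurableSpace X] [TopologicalSpace X] [PolishSpace X] [BorelSpace X]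
  [MeasurableSpace Y] [TopologicalSpace Y] [PolishSpace Y] [BorelSpace Y]

/-- The couplings of two probability measures on Polish spaces form a weakly compact set. -/
theorem isCompact_setOf_coupling (P : Measure X) (Q : Measure Y) [IsProbabilityMeasure P]
    [IsProbabilityMeasure Q] :
    IsCompact {γ : ProbabilityMeasure (X × Y) |
      (γ : Measure (X × Y)).map Prod.fst = P ∧ (γ : Measure (X × Y)).map Prod.snd = Q} := by
  set S := {γ : ProbabilityMeasure (X × Y) |
    (γ : Measure (X × Y)).map Prod.fst = P ∧ (γ : Measure (X × Y)).map Prod.snd = Q}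
  have hclosed : IsClosed S := by
    let P' : ProbabilityMeasure X := ⟨P, inferInstance⟩
    let Q' : ProbabilityMeasure Y := ⟨Q, inferInstance⟩
    have hfst := (isClosed_singleton (x := P')).preimage
      (ProbabilityMeasure.continuous_map (Ω := X × Y) continuous_fst)
    have hsnd := (isClosed_singleton (x := Q')).preimage
      (ProbabilityMeasure.continuous_map (Ω := X × Y) continuous_snd)
    convert! hfst.inter hsnd using 1
    ext γ
    exact and_congr (ProbabilityMeasure.toMeasure_injective.eq_iff
      (a := γ.map measurable_fst.aemeasurable) (b := P'))
      (ProbabilityMeasure.toMeasure_injective.eq_iff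
      (a := γ.map measurable_snd.aemeasurable) (b := Q'))
  have htight : IsTightMeasureSet {(γ : Measure (X × Y)) | γ ∈ S} := by
    refine IsTightMeasureSet.prodMk ((isTightMeasureSet_singleton (μ := P)).subset ?_)
      ((isTightMeasureSet_singleton (μ := Q)).subset ?_)
    · rintro _ ⟨_, ⟨γ, hγ, rfl⟩, rfl⟩
      exact hγ.1
    · rintro _ ⟨_, ⟨γ, hγ, rfl⟩, rfl⟩
      exact hγ.2
  exact hclosed.closure_eq ▸ isCompact_closure_of_isTightMeasureSet htight

/-- Among the couplings of two probability measures on Polish spaces, some coupling gives minimal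
mass to a prescribed open set. -/
theorem exists_coupling_forall_measure_le (P : Measure X) (Q : Measure Y) [IsProbabilityMeasure P]
    [IsProbabilityMeasure Q] {G : Set (X × Y)} (hG : IsOpen G) :
    ∃ γ : Measure (X × Y), (γ.map Prod.fst = P ∧ γ.map Prod.snd = Q) ∧
      ∀ η : Measure (X × Y), η.map Prod.fst = P ∧ η.map Prod.snd = Q → γ G ≤ η G := by
  let PQ : ProbabilityMeasure (X × Y) := ⟨P.prod Q, inferInstance⟩
  obtain ⟨γ, hγ, hmin⟩ := LowerSemicontinuousOn.exists_isMinOn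
    (by exact ⟨PQ, Measure.fst_prod, Measure.snd_prod⟩)
    (isCompact_setOf_coupling P Q)
    ((lowerSemicontinuous_measure_of_isOpen hG).lowerSemicontinuousOn _)
  refine ⟨γ, hγ, fun η hη ↦ ?_⟩
  have hprob : IsProbabilityMeasure η := by
    have : IsProbabilityMeasure (η.map Prod.fst) := hη.1 ▸ inferInstance
    exact Measure.isProbabilityMeasure_of_map Prod.fst
  exact isMinOn_iff.1 hmin ⟨η, hprob⟩ hη

end Coupling

/-- The infimum defining the Lévy–Prokhorov discrepancy is attained. -/
theorem exists_coupling_LPdist_eq {E : Type*} [NormedAddCommGroup E] [MeasurableSpace E]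
    [BorelSpace E] [PolishSpace E] (ε : ℝ) (P Q : Measure E) [IsProbabilityMeasure P]
    [IsProbabilityMeasure Q] :
    ∃ γ : Measure (E × E), (γ.map Prod.fst = P ∧ γ.map Prod.snd = Q) ∧
      γ {p : E × E | ε < ‖p.1 - p.2‖} = LPdist ε P Q := by
  have hG : IsOpen {p : E × E | ε < ‖p.1 - p.2‖} := isOpen_lt (by fun_prop) (by fun_prop)
  obtain ⟨γ, hγ, hmin⟩ := exists_coupling_forall_measure_le P Q hG
  exact ⟨γ, hγ, le_antisymm (le_iInf₂ hmin) (iInf₂_le γ hγ)⟩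

/-- `LP_ε(P,Q) = 0` iff some coupling of `P` and `Q` is concentrated on
`{‖z₁ - z₂‖ ≤ ε}`; consequently `B_{ε,0}(P)` coincides with the `∞`-Wasserstein ball
`{Q : W_∞(P,Q) ≤ ε}`. -/
theorem lp_zero_iff_wasserstein_infty {Z : Type*} [NormedAddCommGroup Z] [NormedSpace ℝ Z]
    [FiniteDimensional ℝ Z] [MeasurableSpace Z] [BorelSpace Z]
    (P Q : Measure Z) [IsProbabilityMeasure P] [IsProbabilityMeasure Q]
    (ε : ℝ) (hε : 0 ≤ ε) :
    (LPdist ε P Q = 0 ↔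
      ∃ γ : Measure (Z × Z), (γ.map Prod.fst = P ∧ γ.map Prod.snd = Q) ∧
        γ {p : Z × Z | ε < ‖p.1 - p.2‖} = 0)
    ∧ (LPdist ε P Q ≤ ENNReal.ofReal 0 ↔
      ∃ γ : Measure (Z × Z), (γ.map Prod.fst = P ∧ γ.map Prod.snd = Q) ∧
        γ {p : Z × Z | ε < ‖p.1 - p.2‖} = 0) := by
  have hiff : LPdist ε P Q = 0 ↔
      ∃ γ : Measure (Z × Z), (γ.map Prod.fst = P ∧ γ.map Prod.snd = Q) ∧
        γ {p : Z × Z | ε < ‖p.1 - p.2‖} = 0 := by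
    have : ProperSpace Z := FiniteDimensional.proper ℝ Z
    refine ⟨fun h ↦ ?_, fun ⟨γ, hγ, hγ₀⟩ ↦ ?_⟩
    · obtain ⟨γ, hγ, hγ_eq⟩ := exists_coupling_LPdist_eq ε P Q
      exact ⟨γ, hγ, hγ_eq.trans h⟩
    · exact le_antisymm (hγ₀ ▸ iInf₂_le γ hγ) zero_le
  exact ⟨hiff, by simpa using hiff⟩
end

section
/- Let P be a Borel probability measure on ℝ, let ε ≥ 0, β ∈ (0,1), and ρ ∈ [0, 1−β). Then for every Borel probability measure Q on ℝ with LP_ε(P,Q) ≤ ρ, one has Quant(β; Q) ≤ Quant(β + ρ; P) + ε. (Upper bound on quantiles over the LP ambiguity set.) -/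
open MeasureTheory

/-- The CDF of a measure on `ℝ`: `F_μ(s) = μ((-∞, s])`. -/
noncomputable def cdf (μ : Measure ℝ) (s : ℝ) : ℝ := (μ (Set.Iic s)).toReal

/-- The `α`-quantile of a measure on `ℝ`: `Quant(α; μ) = inf {s : F_μ(s) ≥ α}`. -/
noncomputable def Quant (α : ℝ) (μ : Measure ℝ) : ℝ := sInf {s : ℝ | α ≤ cdf μ s}

/-- Mass of a lower ray under `P` exceeds that of the `ε`-enlarged ray under `Q` by at most the
Lévy–Prokhorov discrepancy. -/
theorem measure_Iic_le_add_LPdist (P Q : Measure ℝ) (ε s : ℝ) :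
    P (Set.Iic s) ≤ Q (Set.Iic (s + ε)) + LPdist ε P Q := by
  unfold LPdist
  simp only [ENNReal.add_iInf]
  refine le_iInf₂ fun γ hγ => ?_
  obtain ⟨rfl, rfl⟩ := hγ
  rw [Measure.map_apply measurable_fst measurableSet_Iic,
    Measure.map_apply measurable_snd measurableSet_Iic]
  refine (measure_mono fun p hp => ?_).trans (measure_union_le _ _)
  simp only [Set.mem_preimage, Set.mem_Iic, Set.mem_union, Set.mem_ofPred_eq,
    Real.norm_eq_abs] at hp ⊢
  by_contra! hcon
  linarith [neg_abs_le (p.1 - p.2)]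

theorem bddBelow_setOf_le_cdf (μ : Measure ℝ) [IsProbabilityMeasure μ] {α : ℝ} (hα : 0 < α) :
    BddBelow {s : ℝ | α ≤ cdf μ s} := by
  have h : Filter.Tendsto (cdf μ) Filter.atBot (nhds 0) :=
    (ProbabilityTheory.tendsto_cdf_atBot μ).congr (ProbabilityTheory.cdf_eq_real μ)
  obtain ⟨a, ha⟩ := (h.eventually_lt_const hα).exists_forall_of_atBot
  exact ⟨a, fun s hs => le_of_not_ge fun hsa => (ha s hsa).not_ge hs⟩

theorem nonempty_setOf_le_cdf (μ : Measure ℝ) [IsProbabilityMeasure μ] {α : ℝ} (hα : α < 1) :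
    {s : ℝ | α ≤ cdf μ s}.Nonempty := by
  have h : Filter.Tendsto (cdf μ) Filter.atTop (nhds 1) :=
    (ProbabilityTheory.tendsto_cdf_atTop μ).congr (ProbabilityTheory.cdf_eq_real μ)
  obtain ⟨s, hs⟩ := (h.eventually_const_lt hα).exists
  exact ⟨s, hs.le⟩

/-- Upper bound on quantiles over the LP ambiguity set: if `LP_ε(P,Q) ≤ ρ` then
`Quant(β; Q) ≤ Quant(β + ρ; P) + ε`. -/
theorem lp_quantile_upper_bound (P : Measure ℝ) [IsProbabilityMeasure P]
    (ε β ρ : ℝ) (hε : 0 ≤ ε) (hβ : β ∈ Set.Ioo (0:ℝ) 1) (hρ0 : 0 ≤ ρ) (hρ : ρ < 1 - β)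
    (Q : Measure ℝ) [IsProbabilityMeasure Q] (hQ : LPdist ε P Q ≤ ENNReal.ofReal ρ) :
    Quant β Q ≤ Quant (β + ρ) P + ε := by
  rw [← sub_le_iff_le_add]
  refine le_csInf (nonempty_setOf_le_cdf P (by linarith)) fun s hs => ?_
  rw [sub_le_iff_le_add]
  refine csInf_le (bddBelow_setOf_le_cdf Q hβ.1) ?_
  have h : P (Set.Iic s) ≤ Q (Set.Iic (s + ε)) + ENNReal.ofReal ρ :=
    (measure_Iic_le_add_LPdist P Q ε s).trans (by gcongr)
  have h' := ENNReal.toReal_mono (by finiteness) h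
  rw [ENNReal.toReal_add (by finiteness) (by finiteness), ENNReal.toReal_ofReal hρ0] at h'
  simp only [Set.mem_ofPred_eq, cdf] at hs ⊢
  linarith
end

section
/- Let P be a Borel probability measure on ℝ, let ε ≥ 0, β ∈ (0,1), and ρ ∈ (0, 1−β). Then for every δ ∈ (0, min(β, ρ)] there exists a Borel probability measure Q on ℝ with LP_ε(P,Q) ≤ ρ and Quant(β; Q) = Quant(β − δ + ρ; P) + ε. In particular, sup_{Q : LP_ε(P,Q) ≤ ρ} Quant(β; Q) ≥ Quant(β − δ + ρ; P) + ε for every such δ. (Attainment, in the limit δ ↓ 0, of the worst-case quantile over the LP ambiguity set.) -/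
open MeasureTheory

open Set Filter Topology

theorem cdf_eq_probabilityTheory_cdf (μ : Measure ℝ) [IsProbabilityMeasure μ] (s : ℝ) :
    cdf μ s = ProbabilityTheory.cdf μ s := by
  rw [ProbabilityTheory.cdf_eq_real]; rfl

/-- The Galois connection between the quantile function and the CDF. -/
theorem Quant_le_iff (μ : Measure ℝ) [IsProbabilityMeasure μ] {α : ℝ} (h0 : 0 < α) (h1 : α < 1)
    (s : ℝ) : Quant α μ ≤ s ↔ α ≤ cdf μ s := by
  have hmono : Monotone (cdf μ) := fun a b hab => by
    simpa only [cdf_eq_probabilityTheory_cdf] using ProbabilityTheory.monotone_cdf μ hab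
  have hne : {s : ℝ | α ≤ cdf μ s}.Nonempty := by
    obtain ⟨t, ht⟩ := ((ProbabilityTheory.tendsto_cdf_atTop μ).eventually_const_lt h1).exists
    exact ⟨t, by simpa only [mem_ofPred_eq, cdf_eq_probabilityTheory_cdf] using ht.le⟩
  have hbdd : BddBelow {s : ℝ | α ≤ cdf μ s} := by
    obtain ⟨t, ht⟩ := ((ProbabilityTheory.tendsto_cdf_atBot μ).eventually_lt_const h0).exists
    rw [← cdf_eq_probabilityTheory_cdf] at ht
    refine ⟨t, fun s hs => ?_⟩
    by_contra! hst
    exact absurd (hs.trans (hmono hst.le)) (not_le.2 ht)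
  refine ⟨fun h => ?_, fun h => csInf_le hbdd h⟩
  have hlim : Tendsto (cdf μ) (𝓝[>] s) (𝓝 (cdf μ s)) := by
    have := ((ProbabilityTheory.cdf μ).right_continuous s).mono_left
      (nhdsWithin_mono s Ioi_subset_Ici_self)
    rw [← funext (cdf_eq_probabilityTheory_cdf μ)] at this
    exact this
  refine ge_of_tendsto hlim ?_
  filter_upwards [self_mem_nhdsWithin] with t ht
  obtain ⟨u, hu, hut⟩ := exists_lt_of_csInf_lt hne (lt_of_le_of_lt h ht)
  exact le_trans hu (hmono hut.le)

theorem measure_Iio_Quant_le (μ : Measure ℝ) [IsProbabilityMeasure μ] {α : ℝ}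
    (h0 : 0 < α) (h1 : α < 1) : μ (Iio (Quant α μ)) ≤ ENNReal.ofReal α := by
  obtain ⟨u, hu, hlt, hlim⟩ := exists_seq_strictMono_tendsto (Quant α μ)
  rw [← iUnion_Iic_eq_Iio_of_lt_of_tendsto hlt hlim,
    Monotone.measure_iUnion fun i j hij => Iic_subset_Iic.2 (hu.monotone hij)]
  refine iSup_le fun n => ?_
  have h := mt (Quant_le_iff μ h0 h1 (u n)).2 (not_le.2 (hlt n))
  exact (ENNReal.le_ofReal_iff_toReal_le (measure_ne_top _ _) h0.le).2 (not_le.1 h).le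

theorem Quant_le_of_LPdist_le (P Q : Measure ℝ) [IsProbabilityMeasure P] [IsProbabilityMeasure Q]
    {ε β ρ t : ℝ} (h0 : 0 < β) (h1 : β < 1) (hρ : 0 ≤ ρ) (ht : β + ρ < cdf P t)
    (h : LPdist ε P Q ≤ ENNReal.ofReal ρ) : Quant β Q ≤ t + ε := by
  rw [Quant_le_iff Q h0 h1]
  have hlt : LPdist ε P Q < ENNReal.ofReal (cdf P t - β) :=
    h.trans_lt ((ENNReal.ofReal_lt_ofReal_iff (by linarith)).2 (by linarith))
  unfold LPdist at hlt
  simp only [iInf_lt_iff] at hlt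
  obtain ⟨γ, ⟨hγP, hγQ⟩, hγ⟩ := hlt
  have hle : P (Iic t) ≤ Q (Iic (t + ε)) + γ {p : ℝ × ℝ | ε < ‖p.1 - p.2‖} := by
    rw [← hγP, ← hγQ, Measure.map_apply measurable_fst measurableSet_Iic,
      Measure.map_apply measurable_snd measurableSet_Iic]
    refine (measure_mono fun p hp => ?_).trans (measure_union_le _ _)
    by_contra! hc
    simp only [mem_union, mem_preimage, mem_Iic, mem_ofPred_eq, not_or, not_le, not_lt,
      Real.norm_eq_abs] at hc hp
    linarith [neg_abs_le (p.1 - p.2)]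
  have hreal := ENNReal.toReal_mono
    (ENNReal.add_ne_top.2 ⟨measure_ne_top _ _, ENNReal.ofReal_ne_top⟩)
    (hle.trans (add_le_add_right hγ.le _))
  rw [ENNReal.toReal_add (measure_ne_top _ _) ENNReal.ofReal_ne_top,
    ENNReal.toReal_ofReal (by linarith)] at hreal
  change cdf P t ≤ cdf Q (t + ε) + _ at hreal
  linarith

/-- The coupling that translates all mass by `ε`, after first moving the fraction `c` of the mass
below `q` up to `q`. -/
noncomputable def shiftCoupling (P : Measure ℝ) (ε q c : ℝ) : Measure (ℝ × ℝ) :=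
  ENNReal.ofReal (1 - c) • P.map (fun x => (x, x + ε)) +
    ENNReal.ofReal c • P.map (fun x => (x, max x q + ε))

theorem shiftCoupling_map_fst (P : Measure ℝ) (ε q : ℝ) {c : ℝ} (h0 : 0 ≤ c) (h1 : c ≤ 1) :
    (shiftCoupling P ε q c).map Prod.fst = P := by
  rw [shiftCoupling, Measure.map_add _ _ measurable_fst, Measure.map_smul, Measure.map_smul,
    Measure.map_map measurable_fst (by fun_prop), Measure.map_map measurable_fst (by fun_prop)]
  change _ • P.map id + _ • P.map id = P
  rw [Measure.map_id, ← add_smul, ← ENNReal.ofReal_add (by linarith) h0, sub_add_cancel,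
    ENNReal.ofReal_one, one_smul]

theorem isProbabilityMeasure_shiftCoupling (P : Measure ℝ) [IsProbabilityMeasure P] (ε q : ℝ)
    {c : ℝ} (h0 : 0 ≤ c) (h1 : c ≤ 1) : IsProbabilityMeasure (shiftCoupling P ε q c) := by
  constructor
  have h := shiftCoupling_map_fst P ε q h0 h1
  rw [← preimage_univ (f := Prod.fst), ← Measure.map_apply measurable_fst MeasurableSet.univ, h,
    measure_univ]

theorem shiftCoupling_displacement_le (P : Measure ℝ) {ε : ℝ} (hε : 0 ≤ ε) (q c : ℝ) :
    shiftCoupling P ε q c {p : ℝ × ℝ | ε < ‖p.1 - p.2‖} ≤ ENNReal.ofReal c * P (Iio q) := by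
  have hm : MeasurableSet {p : ℝ × ℝ | ε < ‖p.1 - p.2‖} :=
    measurableSet_lt measurable_const (by fun_prop)
  rw [shiftCoupling, Measure.add_apply, Measure.smul_apply, Measure.smul_apply,
    Measure.map_apply (by fun_prop) hm, Measure.map_apply (by fun_prop) hm]
  have hempty : (fun x : ℝ => (x, x + ε)) ⁻¹' {p : ℝ × ℝ | ε < ‖p.1 - p.2‖} = ∅ := by
    ext x
    simp [abs_of_nonneg hε]
  rw [hempty, measure_empty, smul_zero, zero_add, smul_eq_mul]
  gcongr
  intro x hx
  by_contra! hc
  have hc' : q ≤ x := by simpa using hc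
  simp [max_eq_left hc', abs_of_nonneg hε] at hx

theorem cdf_shiftCoupling_map_snd (P : Measure ℝ) [IsProbabilityMeasure P] (ε q s : ℝ) {c : ℝ}
    (h0 : 0 ≤ c) (h1 : c ≤ 1) :
    cdf ((shiftCoupling P ε q c).map Prod.snd) s =
      (1 - c) * cdf P (s - ε) + c * (if q + ε ≤ s then cdf P (s - ε) else 0) := by
  have hA : (fun x : ℝ => (x, x + ε)) ⁻¹' (Prod.snd ⁻¹' Iic s) = Iic (s - ε) := by
    ext x
    simp [le_sub_iff_add_le]
  have hB : (fun x : ℝ => (x, max x q + ε)) ⁻¹' (Prod.snd ⁻¹' Iic s) =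
      if q + ε ≤ s then Iic (s - ε) else ∅ := by
    split_ifs with h <;> ext x <;> simp [← le_sub_iff_add_le] at h ⊢
    · exact fun _ => h
    · exact fun _ => h
  have hm : MeasurableSet (Prod.snd ⁻¹' Iic s : Set (ℝ × ℝ)) := measurable_snd measurableSet_Iic
  rw [cdf, Measure.map_apply measurable_snd measurableSet_Iic, shiftCoupling, Measure.add_apply,
    Measure.smul_apply, Measure.smul_apply, Measure.map_apply (by fun_prop) hm,
    Measure.map_apply (by fun_prop) hm, hA, hB, smul_eq_mul, smul_eq_mul,
    ENNReal.toReal_add (by finiteness) (by finiteness), ENNReal.toReal_mul, ENNReal.toReal_mul,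
    ENNReal.toReal_ofReal (by linarith), ENNReal.toReal_ofReal h0]
  split_ifs <;> simp [cdf]


/-- Attainment (in the limit `δ ↓ 0`) of the worst-case quantile over the LP ambiguity set:
for each `δ ∈ (0, min(β, ρ)]` there is `Q` with `LP_ε(P,Q) ≤ ρ` and
`Quant(β; Q) = Quant(β - δ + ρ; P) + ε`; in particular the worst-case quantile is at least
`Quant(β - δ + ρ; P) + ε`. -/
theorem lp_worst_case_quantile_attainment (P : Measure ℝ) [IsProbabilityMeasure P]
    (ε β ρ : ℝ) (hε : 0 ≤ ε) (hβ : β ∈ Set.Ioo (0:ℝ) 1) (hρ0 : 0 < ρ) (hρ : ρ < 1 - β) :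
    ∀ δ : ℝ, 0 < δ → δ ≤ min β ρ →
      (∃ Q : Measure ℝ, IsProbabilityMeasure Q ∧
          LPdist ε P Q ≤ ENNReal.ofReal ρ ∧
          Quant β Q = Quant (β - δ + ρ) P + ε) ∧
      Quant (β - δ + ρ) P + ε ≤
        sSup {x : ℝ | ∃ Q : Measure ℝ, IsProbabilityMeasure Q ∧
          LPdist ε P Q ≤ ENNReal.ofReal ρ ∧ Quant β Q = x} := by
  intro δ hδ hδmin
  obtain ⟨hβ0, hβ1⟩ := hβ
  obtain ⟨hδβ, hδρ⟩ := le_min_iff.1 hδmin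
  set α := β - δ + ρ with hα
  have hα0 : 0 < α := by linarith
  have hα1 : α < 1 := by linarith
  set q := Quant α P with hq
  have hattain : ∃ Q : Measure ℝ, IsProbabilityMeasure Q ∧
      LPdist ε P Q ≤ ENNReal.ofReal ρ ∧ Quant β Q = q + ε := by
    set c := ρ / α with hc
    have hc0 : 0 ≤ c := by positivity
    have hc1 : c ≤ 1 := (div_le_one hα0).2 (by linarith)
    have hcα : c * α = ρ := div_mul_cancel₀ _ hα0.ne'
    have := isProbabilityMeasure_shiftCoupling P ε q hc0 hc1
    have hQ : IsProbabilityMeasure ((shiftCoupling P ε q c).map Prod.snd) :=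
      Measure.isProbabilityMeasure_map (by fun_prop)
    refine ⟨(shiftCoupling P ε q c).map Prod.snd, hQ, ?_, ?_⟩
    · calc LPdist ε P ((shiftCoupling P ε q c).map Prod.snd)
          ≤ shiftCoupling P ε q c {p : ℝ × ℝ | ε < ‖p.1 - p.2‖} :=
            iInf₂_le _ ⟨shiftCoupling_map_fst P ε q hc0 hc1, rfl⟩
        _ ≤ ENNReal.ofReal c * P (Iio q) := shiftCoupling_displacement_le P hε q c
        _ ≤ ENNReal.ofReal c * ENNReal.ofReal α := by
            gcongr
            exact measure_Iio_Quant_le P hα0 hα1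
        _ = ENNReal.ofReal ρ := by rw [← ENNReal.ofReal_mul hc0, hcα]
    · apply le_antisymm
      · rw [Quant_le_iff _ hβ0 hβ1, cdf_shiftCoupling_map_snd P ε q _ hc0 hc1, if_pos le_rfl,
          add_sub_cancel_right]
        have := (Quant_le_iff P hα0 hα1 q).1 le_rfl
        linarith
      · by_contra! hlt
        have hle := (Quant_le_iff ((shiftCoupling P ε q c).map Prod.snd) hβ0 hβ1 _).1 le_rfl
        rw [cdf_shiftCoupling_map_snd P ε q _ hc0 hc1, if_neg (not_le.2 hlt)] at hle
        have hP := not_le.1 (mt (Quant_le_iff P hα0 hα1 _).2 (not_le.2 (sub_lt_iff_lt_add.2 hlt)))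
        have := mul_le_mul_of_nonneg_left hP.le (sub_nonneg.2 hc1)
        linarith
  refine ⟨hattain, le_csSup ?_ hattain⟩
  obtain ⟨t, ht⟩ := ((ProbabilityTheory.tendsto_cdf_atTop P).eventually_const_lt
    (show β + ρ < 1 by linarith)).exists
  rw [← cdf_eq_probabilityTheory_cdf] at ht
  refine ⟨t + ε, ?_⟩
  rintro x ⟨Q, hQ, hLP, rfl⟩
  exact Quant_le_of_LPdist_le P Q hβ0 hβ1 hρ0.le ht hLP
end
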